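/- arXiv:0804.3530 — 4 statements merged into one kernel-verified Lean document; each statement's English description precedes it below -/
import Mathlib

section
/- Let (Y, μ) be a finite measure space and (F_n)_{n∈ℕ} a sequence of measurable subsets of Y with Σ_{n=1}^∞ μ(F_n) = ∞. Suppose there exist n₀ ∈ ℕ and C > 0 such that μ(F_n ∩ F_m) ≤ C·μ(F_n)·μ(F_m) for all m, n ∈ ℕ with |m − n| ≥ n₀. Then μ(limsup_n F_n) > 0, where limsup_n F_n = ⋂_{n∈ℕ} ⋃_{m ≥ n} F_m. -/
open MeasureTheory
open scoped NNReal ENNReal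

/-- The **Chung–Erdős inequality** for finitely many measurable sets. -/
lemma sq_sum_measureReal_le {Y ι : Type*} [MeasurableSpace Y] (μ : Measure Y) [IsFiniteMeasure μ]
    {F : ι → Set Y} (hF : ∀ i, MeasurableSet (F i)) (s : Finset ι) :
    (∑ i ∈ s, μ.real (F i)) ^ 2 ≤
      μ.real (⋃ i ∈ s, F i) * ∑ i ∈ s, ∑ j ∈ s, μ.real (F i ∩ F j) := by
  have hU : MeasurableSet (⋃ i ∈ s, F i) := s.measurableSet_biUnion fun i _ ↦ hF i
  have hint : ∀ A : Set Y, MeasurableSet A → Integrable (A.indicator (1 : Y → ℝ)) μ :=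
    fun A hA ↦ (integrable_const (1 : ℝ)).indicator hA
  have key : ∀ t : ℝ, 0 ≤ (∑ i ∈ s, ∑ j ∈ s, μ.real (F i ∩ F j)) * (t * t) +
      (-2 * ∑ i ∈ s, μ.real (F i)) * t + μ.real (⋃ i ∈ s, F i) := by
    intro t
    have hpt : ∀ y, 0 ≤ (∑ i ∈ s, ∑ j ∈ s, (F i ∩ F j).indicator (1 : Y → ℝ) y) * (t * t) +
        (-2 * ∑ i ∈ s, (F i).indicator (1 : Y → ℝ) y) * t +
        (⋃ i ∈ s, F i).indicator (1 : Y → ℝ) y := by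
      intro y
      simp_rw [Set.inter_indicator_one, Pi.mul_apply, ← Finset.sum_mul_sum]
      by_cases hy : y ∈ ⋃ i ∈ s, F i
      · rw [Set.indicator_of_mem hy, Pi.one_apply]
        nlinarith [sq_nonneg (t * (∑ i ∈ s, (F i).indicator (1 : Y → ℝ) y) - 1)]
      · have h0 : ∑ i ∈ s, (F i).indicator (1 : Y → ℝ) y = 0 :=
          Finset.sum_eq_zero fun i hi ↦ Set.indicator_of_notMem
            (fun h ↦ hy (Set.mem_biUnion hi h)) _
        simp [h0, Set.indicator_of_notMem hy]
    have h1 : Integrable (fun y ↦ ∑ i ∈ s, (F i).indicator (1 : Y → ℝ) y) μ :=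
      integrable_finsetSum _ fun i _ ↦ hint _ (hF i)
    have h2 : Integrable (fun y ↦ ∑ i ∈ s, ∑ j ∈ s, (F i ∩ F j).indicator (1 : Y → ℝ) y) μ :=
      integrable_finsetSum _ fun i _ ↦ integrable_finsetSum _ fun j _ ↦
        hint _ ((hF i).inter (hF j))
    have h3 : Integrable (fun y ↦
        (∑ i ∈ s, ∑ j ∈ s, (F i ∩ F j).indicator (1 : Y → ℝ) y) * (t * t) +
        (-2 * ∑ i ∈ s, (F i).indicator (1 : Y → ℝ) y) * t) μ :=
      (h2.mul_const _).add ((h1.const_mul _).mul_const _)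
    have h := integral_nonneg_of_ae (μ := μ) (Filter.Eventually.of_forall hpt)
    rw [integral_add h3 (hint _ hU),
      integral_add (h2.mul_const _) ((h1.const_mul _).mul_const _), integral_mul_const,
      integral_mul_const, integral_const_mul, integral_indicator_one hU,
      integral_finsetSum _ fun i _ ↦ hint _ (hF i),
      integral_finsetSum _ fun i _ ↦ integrable_finsetSum _ fun j _ ↦
        hint _ ((hF i).inter (hF j))] at h
    simp_rw [integral_finsetSum s fun j _ ↦ hint _ ((hF _).inter (hF j)),
      integral_indicator_one (hF _), integral_indicator_one ((hF _).inter (hF _))] at h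
    exact h
  have := discrim_le_zero key
  rw [discrim] at this
  linarith

/-- Under quasi-independence of pairs of sets whose indices differ by at least `n₀`, a finite
subfamily of total measure at least one has a union of measure bounded below. -/
lemma one_le_mul_measureReal_biUnion {Y : Type*} [MeasurableSpace Y] (μ : Measure Y)
    [IsFiniteMeasure μ] {F : ℕ → Set Y} (hF : ∀ n, MeasurableSet (F n)) {n₀ : ℕ} {C : ℝ}
    (hC : 0 ≤ C)
    (hquasi : ∀ m n : ℕ, n₀ ≤ Nat.dist m n →
      μ.real (F n ∩ F m) ≤ C * μ.real (F n) * μ.real (F m))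
    {s : Finset ℕ} (hs : 1 ≤ ∑ i ∈ s, μ.real (F i)) :
    1 ≤ (C + 2 * n₀) * μ.real (⋃ i ∈ s, F i) := by
  set S := ∑ i ∈ s, μ.real (F i)
  have hpair : ∀ i j, μ.real (F i ∩ F j) ≤
      C * μ.real (F i) * μ.real (F j) + if Nat.dist j i < n₀ then μ.real (F i) else 0 := by
    intro i j
    split_ifs with h
    · have : μ.real (F i ∩ F j) ≤ μ.real (F i) := measureReal_mono Set.inter_subset_left
      have : 0 ≤ C * μ.real (F i) * μ.real (F j) := by positivity
      linarith
    · simpa using hquasi j i (not_lt.mp h)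
  have hrow : ∀ i, ∑ j ∈ s, (if Nat.dist j i < n₀ then μ.real (F i) else 0) ≤
      2 * n₀ * μ.real (F i) := by
    intro i
    rw [← Finset.sum_filter, Finset.sum_const, nsmul_eq_mul]
    have hsub : s.filter (fun j ↦ Nat.dist j i < n₀) ⊆ Finset.Ico (i - n₀) (i + n₀) := by
      intro j hj
      have := (Finset.mem_filter.mp hj).2
      simp only [Nat.dist] at this
      rw [Finset.mem_Ico]
      omega
    have hcard : (s.filter (fun j ↦ Nat.dist j i < n₀)).card ≤ 2 * n₀ := by
      refine (Finset.card_le_card hsub).trans ?_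
      rw [Nat.card_Ico]
      omega
    gcongr
    exact_mod_cast hcard
  have hD : ∑ i ∈ s, ∑ j ∈ s, μ.real (F i ∩ F j) ≤ C * S ^ 2 + 2 * n₀ * S := by
    calc ∑ i ∈ s, ∑ j ∈ s, μ.real (F i ∩ F j)
        ≤ ∑ i ∈ s, (C * μ.real (F i) * S + 2 * n₀ * μ.real (F i)) := by
          refine Finset.sum_le_sum fun i _ ↦ (Finset.sum_le_sum fun j _ ↦ hpair i j).trans ?_
          rw [Finset.sum_add_distrib, ← Finset.mul_sum]
          gcongr
          exact hrow i
      _ = C * S ^ 2 + 2 * n₀ * S := by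
          rw [Finset.sum_add_distrib, ← Finset.sum_mul, ← Finset.mul_sum, ← Finset.mul_sum]
          ring
  have hD' : C * S ^ 2 + 2 * n₀ * S ≤ (C + 2 * n₀) * S ^ 2 := by
    have : (2 * n₀ : ℝ) * S ≤ 2 * n₀ * S ^ 2 := by
      gcongr
      exact le_self_pow₀ hs two_ne_zero
    linarith
  have h := (sq_sum_measureReal_le μ hF s).trans
    (mul_le_mul_of_nonneg_left (hD.trans hD') measureReal_nonneg)
  refine le_of_mul_le_mul_right (a := S ^ 2) ?_ (by positivity)
  linarith

/-- **A converse to the Borel–Cantelli lemma** (Sullivan; Proposition 4.1 of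
Gorodnik–Shah, "Khinchin theorem for integral points on quadratic varieties").

Let `(Y, μ)` be a finite measure space and `(F_n)` a sequence of measurable subsets
of `Y` with `∑ μ(F_n) = ∞`.  Suppose there exist `n₀ ∈ ℕ` and a constant `C > 0`
such that `μ(F_n ∩ F_m) ≤ C μ(F_n) μ(F_m)` whenever `|m − n| ≥ n₀`.  Then the set
`F = ⋂_n ⋃_{m ≥ n} F_m` of points lying in infinitely many of the `F_n` satisfies
`μ(F) > 0`. -/
theorem quasi_independent_borel_cantelli
    {Y : Type*} [MeasurableSpace Y] (μ : Measure Y) [IsFiniteMeasure μ]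
    (F : ℕ → Set Y) (hFmeas : ∀ n, MeasurableSet (F n))
    (hdiv : ∑' n, μ (F n) = ⊤)
    (n₀ : ℕ) (C : ℝ≥0) (hC : 0 < C)
    (hquasi : ∀ m n : ℕ, n₀ ≤ Nat.dist m n → μ (F n ∩ F m) ≤ C * μ (F n) * μ (F m)) :
    0 < μ (⋂ n : ℕ, ⋃ m ≥ n, F m) := by
  have hreal : ∀ m n : ℕ, n₀ ≤ Nat.dist m n →
      μ.real (F n ∩ F m) ≤ C * μ.real (F n) * μ.real (F m) := by
    intro m n h
    have := ENNReal.toReal_mono (by finiteness) (hquasi m n h)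
    simpa [Measure.real, ENNReal.toReal_mul] using this
  have hdivtail : ∀ N, ∃ s : Finset ℕ, (∀ i ∈ s, N ≤ i) ∧ 1 ≤ ∑ i ∈ s, μ.real (F i) := by
    intro N
    have hlarge : ∑ i ∈ Finset.range N, μ (F i) + 1 < ∑' n, μ (F n) := by
      rw [hdiv]
      exact ENNReal.add_lt_top.mpr
        ⟨ENNReal.sum_lt_top.mpr fun i _ ↦ measure_lt_top _ _, ENNReal.one_lt_top⟩
    rw [ENNReal.tsum_eq_iSup_nat, lt_iSup_iff] at hlarge
    obtain ⟨M, hM⟩ := hlarge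
    have hNM : N ≤ M := by
      by_contra! h
      refine absurd hM (not_lt.mpr (le_add_right ?_))
      exact Finset.sum_le_sum_of_subset (Finset.range_mono h.le)
    refine ⟨Finset.Ico N M, fun i hi ↦ (Finset.mem_Ico.mp hi).1, ?_⟩
    rw [← Finset.sum_range_add_sum_Ico _ hNM] at hM
    have h1 : 1 ≤ ∑ i ∈ Finset.Ico N M, μ (F i) := (lt_of_add_lt_add_left hM).le
    have := ENNReal.toReal_mono (ENNReal.sum_ne_top.mpr fun i _ ↦ measure_ne_top _ _) h1
    rwa [ENNReal.toReal_sum fun i _ ↦ measure_ne_top _ _, ENNReal.toReal_one] at this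
  have hK : (0 : ℝ) < C + 2 * n₀ := by positivity
  have hbound : ∀ N, ENNReal.ofReal (C + 2 * n₀)⁻¹ ≤ μ (⋃ m ≥ N, F m) := by
    intro N
    obtain ⟨s, hsN, hs⟩ := hdivtail N
    have h := one_le_mul_measureReal_biUnion μ hFmeas C.coe_nonneg hreal hs
    refine (ENNReal.ofReal_le_of_le_toReal ((inv_le_iff_one_le_mul₀' hK).mpr h)).trans ?_
    exact measure_mono (Set.biUnion_subset_biUnion_left hsN)
  have hanti : Antitone fun N ↦ ⋃ m ≥ N, F m :=
    fun _ _ h ↦ Set.biUnion_subset_biUnion_left fun _ hm ↦ h.trans hm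
  rw [hanti.measure_iInter (fun N ↦ (MeasurableSet.biUnion (Set.to_countable _)
    fun m _ ↦ hFmeas m).nullMeasurableSet) ⟨0, measure_ne_top _ _⟩]
  exact (ENNReal.ofReal_pos.mpr (inv_pos.mpr hK)).trans_le (le_iInf hbound)
end

section
/- Let φ : ℝ → (0,∞) be a measurable function for which there exists c > 1 with c⁻¹ φ(x) ≤ φ(x+h) ≤ c φ(x) for all x ∈ ℝ and all h ∈ [−1,1]. If ∫₀^∞ φ(t) dt = ∞, then there exist c′ > 1 and a measurable function φ₁ : (0,∞) → (0,1] such that: c′⁻¹ φ₁(x) ≤ φ₁(x+h) ≤ c′ φ₁(x) for all x ≥ 1 and h ∈ [−1,1]; φ₁(t) ≤ φ(t) for all t > 0; φ₁(t) → 0 as t → ∞; φ(t)/φ₁(t) → ∞ as t → ∞; and ∫₀^∞ φ₁(t) dt = ∞. -/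
open MeasureTheory

open Filter Topology in
/-- The primitive from `0` of a nonnegative function that is not integrable on the positive
half-line tends to infinity. -/
theorem tendsto_primitive_atTop_of_not_integrableOn {ψ : ℝ → ℝ} (h0 : ∀ x, 0 ≤ ψ x)
    (hloc : ∀ a b, IntervalIntegrable ψ volume a b) (hni : ¬ IntegrableOn ψ (Set.Ioi 0)) :
    Tendsto (fun t => ∫ s in (0 : ℝ)..t, ψ s) atTop atTop := by
  have hmono : Monotone (fun t => ∫ s in (0 : ℝ)..t, ψ s) := fun a b hab => by
    have h := intervalIntegral.integral_add_adjacent_intervals (hloc 0 a) (hloc a b)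
    have h' := intervalIntegral.integral_nonneg (μ := volume) hab (fun u _ => h0 u)
    dsimp only
    linarith
  refine tendsto_atTop_atTop_of_monotone hmono fun B => ?_
  by_contra! hB
  refine hni (integrableOn_Ioi_of_intervalIntegral_norm_bounded (l := atTop) (b := id) B 0
    (fun i => ?_) tendsto_id (Eventually.of_forall fun i => ?_))
  · rcases le_total 0 i with hi | hi
    · exact (intervalIntegrable_iff_integrableOn_Ioc_of_le hi).1 (hloc 0 i)
    · simp [Set.Ioc_eq_empty_of_le hi]
  · simpa only [Real.norm_of_nonneg (h0 _), id] using (hB i).le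

open Filter Topology in
/-- Abel–Dini theorem for integrals: dividing a nonnegative non-integrable function by one plus its
primitive does not make it integrable. -/
theorem not_integrableOn_div_one_add_primitive {ψ : ℝ → ℝ} (h0 : ∀ x, 0 ≤ ψ x)
    (hloc : ∀ a b, IntervalIntegrable ψ volume a b) (hni : ¬ IntegrableOn ψ (Set.Ioi 0)) :
    ¬ IntegrableOn (fun t => ψ t / (1 + ∫ s in (0 : ℝ)..t, ψ s)) (Set.Ioi 0) := by
  intro hint
  set F : ℝ → ℝ := fun t => ∫ s in (0 : ℝ)..t, ψ s with hF
  have hFtop : Tendsto F atTop atTop := tendsto_primitive_atTop_of_not_integrableOn h0 hloc hni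
  have hsub : ∀ a b, ∫ s in a..b, ψ s = F b - F a := fun a b =>
    (intervalIntegral.integral_interval_sub_left (hloc 0 b) (hloc 0 a)).symm
  have hmono : Monotone F := fun a b hab => by
    have := intervalIntegral.integral_nonneg (μ := volume) hab (fun u _ => h0 u)
    linarith [hsub a b]
  have hF0 : F 0 = 0 := by simp [hF]
  have hFnn : ∀ t, 0 ≤ t → 0 ≤ F t := fun t ht => hF0 ▸ hmono ht
  have hgi : ∀ a b, 0 ≤ a → a ≤ b →
      IntervalIntegrable (fun t => ψ t / (1 + F t)) volume a b := fun a b ha hab =>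
    (intervalIntegrable_iff_integrableOn_Ioc_of_le hab).2
      (hint.mono_set fun x hx => lt_of_le_of_lt ha hx.1)
  have hlim := intervalIntegral_tendsto_integral_Ioi 0 hint tendsto_id
  obtain ⟨a, ha⟩ := Metric.cauchySeq_iff.1 hlim.cauchySeq (1 / 2) (by norm_num)
  set a' := max a 0
  obtain ⟨b, hb, hab⟩ : ∃ b, 2 * (1 + F a') ≤ F b ∧ a' ≤ b :=
    ((hFtop.eventually_ge_atTop _).and (eventually_ge_atTop a')).exists
  have ha0 : 0 ≤ a' := le_max_right _ _
  have hdist := ha b ((le_max_left a 0).trans hab) a' (le_max_left _ _)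
  have hFa := hFnn a' ha0
  have key : (F b - F a') / (1 + F b) ≤ ∫ t in a'..b, ψ t / (1 + F t) := by
    rw [← hsub, ← intervalIntegral.integral_div]
    refine intervalIntegral.integral_mono_on hab ((hloc a' b).div_const _) (hgi a' b ha0 hab)
      fun t ht => ?_
    have := hFnn t (ha0.trans ht.1)
    exact div_le_div_of_nonneg_left (h0 t) (by linarith) (by linarith [hmono ht.2])
  have hhalf : 1 / 2 ≤ (F b - F a') / (1 + F b) := by
    rw [div_le_div_iff₀ (by norm_num) (by linarith)]
    linarith
  rw [Real.dist_eq, id, id, intervalIntegral.integral_interval_sub_left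
    (hgi 0 b le_rfl (ha0.trans hab)) (hgi 0 a' le_rfl ha0)] at hdist
  linarith [le_abs_self (∫ t in a'..b, ψ t / (1 + F t))]

open Filter Topology in
/-- An integrable function that varies by at most a constant factor over unit steps tends to
zero. -/
theorem tendsto_zero_of_integrableOn_of_le_mul {ψ : ℝ → ℝ} (h0 : ∀ x, 0 ≤ ψ x)
    {c : ℝ} (hψ : ∀ x, ∀ h ∈ Set.Icc (0 : ℝ) 1, ψ x ≤ c * ψ (x + h))
    (hint : IntegrableOn ψ (Set.Ioi 0)) : Tendsto ψ atTop (𝓝 0) := by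
  have hi : ∀ b, 0 ≤ b → IntervalIntegrable ψ volume 0 b := fun b hb =>
    (intervalIntegrable_iff_integrableOn_Ioc_of_le hb).2 (hint.mono_set fun x hx => hx.1)
  have hlim := intervalIntegral_tendsto_integral_Ioi 0 hint tendsto_id
  have hlim' := intervalIntegral_tendsto_integral_Ioi 0 hint
    (tendsto_atTop_add_const_right atTop (1 : ℝ) tendsto_id)
  have hz := (hlim'.sub hlim).const_mul c
  rw [sub_self, mul_zero] at hz
  refine tendsto_of_tendsto_of_tendsto_of_le_of_le' tendsto_const_nhds hz
    (Eventually.of_forall h0) ?_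
  filter_upwards [eventually_ge_atTop 0] with t ht
  have hi' : IntervalIntegrable ψ volume t (t + 1) :=
    (hi t ht).symm.trans (hi (t + 1) (by linarith))
  simp only [id]
  rw [intervalIntegral.integral_interval_sub_left (hi _ (by linarith)) (hi _ ht),
    ← intervalIntegral.integral_const_mul]
  have : ∫ _ in t..t + 1, ψ t ≤ ∫ s in t..t + 1, c * ψ s := by
    refine intervalIntegral.integral_mono_on (by linarith) intervalIntegrable_const
      (hi'.const_mul c) fun s hs => ?_
    simpa using hψ t (s - t) ⟨by linarith [hs.1], by linarith [hs.2]⟩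
  simpa using this

/-- A function that grows by at most a constant factor over unit steps grows at most
exponentially. -/
theorem le_pow_mul_of_le_mul {φ : ℝ → ℝ} {c : ℝ} (hc : 1 ≤ c)
    (hφ : ∀ x, ∀ h ∈ Set.Icc (0 : ℝ) 1, φ (x + h) ≤ c * φ x) (n : ℕ) :
    ∀ x : ℝ, 0 ≤ x → x ≤ n → φ x ≤ c ^ n * φ 0 := by
  induction n with
  | zero =>
    intro x hx hx'
    simp [le_antisymm (by simpa using hx') hx]
  | succ n ih =>
    intro x hx hx'
    push_cast at hx'
    have hstep := hφ (max (x - 1) 0) (x - max (x - 1) 0)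
      ⟨sub_nonneg.2 (max_le (by linarith) hx), by linarith [le_max_left (x - 1) 0]⟩
    rw [add_sub_cancel] at hstep
    calc φ x ≤ c * φ (max (x - 1) 0) := hstep
      _ ≤ c * (c ^ n * φ 0) := by
        gcongr
        exact ih _ (le_max_right _ _) (max_le (by linarith) n.cast_nonneg)
      _ = c ^ (n + 1) * φ 0 := by ring

open Filter Topology in
/-- Truncating a doubling function at height one preserves non-integrability. -/
theorem not_integrableOn_min_one {φ : ℝ → ℝ} (h0 : ∀ x, 0 < φ x) (hm : Measurable φ)
    {c : ℝ} (hc : 1 ≤ c) (hup : ∀ x, ∀ h ∈ Set.Icc (0 : ℝ) 1, φ (x + h) ≤ c * φ x)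
    (hlow : ∀ x, ∀ h ∈ Set.Icc (0 : ℝ) 1, φ x ≤ c * φ (x + h))
    (hni : ¬ IntegrableOn φ (Set.Ioi 0)) :
    ¬ IntegrableOn (fun x => min (φ x) 1) (Set.Ioi 0) := by
  intro hint
  have hz := tendsto_zero_of_integrableOn_of_le_mul (c := c)
    (fun x => (lt_min (h0 x) one_pos).le)
    (fun x h hh => by
      rw [mul_min_of_nonneg _ _ (zero_le_one.trans hc), mul_one]
      exact min_le_min (hlow x h hh) hc) hint
  obtain ⟨T, hT⟩ := eventually_atTop.1 (hz.eventually_lt_const one_pos)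
  obtain ⟨n, hn⟩ := exists_nat_ge T
  apply hni
  rw [← Set.Ioc_union_Ioi_eq_Ioi (n.cast_nonneg : (0 : ℝ) ≤ n)]
  refine IntegrableOn.union ?_ ?_
  · refine Measure.integrableOn_of_bounded (M := c ^ n * φ 0) (by simp) hm.aestronglyMeasurable ?_
    filter_upwards [ae_restrict_mem measurableSet_Ioc] with x hx
    rw [Real.norm_of_nonneg (h0 x).le]
    exact le_pow_mul_of_le_mul hc hup n x hx.1.le hx.2
  · refine (hint.mono_set (Set.Ioi_subset_Ioi n.cast_nonneg)).congr_fun (fun x hx => ?_)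
      measurableSet_Ioi
    rcases min_lt_iff.1 (hT x (hn.trans (le_of_lt hx))) with h | h
    · exact min_eq_left h.le
    · exact absurd h (lt_irrefl _)

/-- Lemma 2.2(ii) of Gorodnik–Shah, "Khinchin theorem for integral points on
quadratic varieties".

Let `φ : ℝ → (0,∞)` be a measurable function such that for some `c > 1` one has
`c⁻¹ φ(x) ≤ φ(x+h) ≤ c φ(x)` for all `x ∈ ℝ` and `h ∈ [−1,1]`.
If `∫₀^∞ φ(t) dt = ∞`, then there exist `c′ > 1` and a measurable function
`φ₁ : (0,∞) → (0,1]` satisfying the analogous doubling condition (with constant `c′`,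
for `x ≥ 1`), such that `φ₁ ≤ φ`, `φ₁(t) → 0` and `φ(t)/φ₁(t) → ∞` as `t → ∞`,
and `∫₀^∞ φ₁(t) dt = ∞`. -/
theorem exists_smaller_divergent_of_doubling
    (φ : ℝ → ℝ) (hφpos : ∀ x : ℝ, 0 < φ x) (hφmeas : Measurable φ)
    (c : ℝ) (hc : 1 < c)
    (hdoub : ∀ x : ℝ, ∀ h ∈ Set.Icc (-1 : ℝ) 1,
      c⁻¹ * φ x ≤ φ (x + h) ∧ φ (x + h) ≤ c * φ x)
    (hint : ∫⁻ t in Set.Ioi (0 : ℝ), ENNReal.ofReal (φ t) = ⊤) :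
    ∃ (c' : ℝ), 1 < c' ∧ ∃ φ₁ : ℝ → ℝ, Measurable φ₁ ∧
      (∀ t : ℝ, 0 < t → 0 < φ₁ t ∧ φ₁ t ≤ 1) ∧
      (∀ x : ℝ, 1 ≤ x → ∀ h ∈ Set.Icc (-1 : ℝ) 1,
        c'⁻¹ * φ₁ x ≤ φ₁ (x + h) ∧ φ₁ (x + h) ≤ c' * φ₁ x) ∧
      (∀ t : ℝ, 0 < t → φ₁ t ≤ φ t) ∧
      Filter.Tendsto φ₁ Filter.atTop (nhds 0) ∧
      Filter.Tendsto (fun t => φ t / φ₁ t) Filter.atTop Filter.atTop ∧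
      ∫⁻ t in Set.Ioi (0 : ℝ), ENNReal.ofReal (φ₁ t) = ⊤ := by
  have hc0 : 0 < c := one_pos.trans hc
  have hlow : ∀ x, ∀ h ∈ Set.Icc (-1 : ℝ) 1, φ x ≤ c * φ (x + h) := fun x h hh =>
    (inv_mul_le_iff₀ hc0).1 (hdoub x h hh).1
  have hIcc : Set.Icc (0 : ℝ) 1 ⊆ Set.Icc (-1) 1 := Set.Icc_subset_Icc_left (by norm_num)
  have hφni : ¬ IntegrableOn φ (Set.Ioi 0) := fun h =>
    (lintegral_ofReal_ne_top_iff_integrable hφmeas.aestronglyMeasurable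
      (Filter.Eventually.of_forall fun x => (hφpos x).le)).2 h hint
  set ψ : ℝ → ℝ := fun x => min (φ x) 1 with hψ
  have hψpos : ∀ x, 0 < ψ x := fun x => lt_min (hφpos x) one_pos
  have hψ0 : ∀ x, 0 ≤ ψ x := fun x => (hψpos x).le
  have hψ1 : ∀ x, ψ x ≤ 1 := fun x => min_le_right _ _
  have hψmeas : Measurable ψ := hφmeas.min measurable_const
  have hψup : ∀ x, ∀ h ∈ Set.Icc (-1 : ℝ) 1, ψ (x + h) ≤ c * ψ x := fun x h hh => by
    rw [hψ, mul_min_of_nonneg _ _ hc0.le, mul_one]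
    exact min_le_min (hdoub x h hh).2 hc.le
  have hψlow : ∀ x, ∀ h ∈ Set.Icc (-1 : ℝ) 1, ψ x ≤ c * ψ (x + h) := fun x h hh => by
    rw [hψ, mul_min_of_nonneg _ _ hc0.le, mul_one]
    exact min_le_min (hlow x h hh) hc.le
  have hψni : ¬ IntegrableOn ψ (Set.Ioi 0) := not_integrableOn_min_one hφpos hφmeas hc.le
    (fun x h hh => (hdoub x h (hIcc hh)).2) (fun x h hh => hlow x h (hIcc hh)) hφni
  have hloc : ∀ a b, IntervalIntegrable ψ volume a b := fun a b =>
    (intervalIntegrable_const (c := (1 : ℝ))).mono_fun hψmeas.aestronglyMeasurable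
      (Filter.Eventually.of_forall fun x => by
        simpa [abs_of_nonneg (hψ0 x)] using hψ1 x)
  set Ψ : ℝ → ℝ := fun t => 1 + ∫ s in (0 : ℝ)..t, ψ s with hΨ
  have hΨtop : Filter.Tendsto Ψ Filter.atTop Filter.atTop :=
    Filter.tendsto_atTop_add_const_left _ _
      (tendsto_primitive_atTop_of_not_integrableOn hψ0 hloc hψni)
  have hΨmeas : Measurable Ψ :=
    (continuous_const.add (intervalIntegral.continuous_primitive hloc 0)).measurable
  have hΨ1 : ∀ t, 0 ≤ t → 1 ≤ Ψ t := fun t ht =>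
    le_add_of_nonneg_right (intervalIntegral.integral_nonneg ht fun u _ => hψ0 u)
  have hΨlip : ∀ s t, |s - t| ≤ 1 → Ψ s ≤ Ψ t + 1 := fun s t hst => by
    have h1 : Ψ s - Ψ t = ∫ u in t..s, ψ u := by
      rw [← intervalIntegral.integral_interval_sub_left (hloc 0 s) (hloc 0 t)]
      simp only [hΨ]
      ring
    have h2 : ‖∫ u in t..s, ψ u‖ ≤ 1 * |s - t| :=
      intervalIntegral.norm_integral_le_of_norm_le_const fun u _ => by
        rw [Real.norm_of_nonneg (hψ0 u)]
        exact hψ1 u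
    linarith [Real.le_norm_self (∫ u in t..s, ψ u)]
  have hdiv_le : ∀ t, 0 ≤ t → ψ t / Ψ t ≤ ψ t := fun t ht => div_le_self (hψ0 t) (hΨ1 t ht)
  have hratio : ∀ s t, 0 ≤ s → 0 ≤ t → |s - t| ≤ 1 → ψ t ≤ c * ψ s →
      ψ t / Ψ t ≤ 2 * c * (ψ s / Ψ s) := fun s t hs ht hst hle => by
    have hs1 := hΨ1 s hs
    have ht1 := hΨ1 t ht
    rw [← mul_div_assoc, div_le_div_iff₀ (by linarith) (by linarith)]
    calc ψ t * Ψ s ≤ (c * ψ s) * (2 * Ψ t) :=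
          mul_le_mul hle (by linarith [hΨlip s t hst]) (by linarith)
            (mul_nonneg hc0.le (hψ0 s))
      _ = 2 * c * ψ s * Ψ t := by ring
  refine ⟨2 * c, by linarith, fun t => ψ t / Ψ t, hψmeas.div hΨmeas, fun t ht => ?_,
    fun x hx h hh => ?_, fun t ht => ?_, ?_, ?_, ?_⟩
  · exact ⟨div_pos (hψpos t) (one_pos.trans_le (hΨ1 t ht.le)), (hdiv_le t ht.le).trans (hψ1 t)⟩
  · have habs : |h| ≤ 1 := abs_le.2 hh
    have hxh : 0 ≤ x + h := by linarith [hh.1]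
    have hx0 : 0 ≤ x := zero_le_one.trans hx
    refine ⟨(inv_mul_le_iff₀ (by linarith)).2 ?_, ?_⟩
    · exact hratio (x + h) x hxh hx0 (by simpa using habs) (hψlow x h hh)
    · exact hratio x (x + h) hx0 hxh (by simpa using habs) (hψup x h hh)
  · exact (hdiv_le t ht.le).trans (min_le_left _ _)
  · refine tendsto_of_tendsto_of_tendsto_of_le_of_le' tendsto_const_nhds
      hΨtop.inv_tendsto_atTop ?_ ?_
    · filter_upwards [Filter.eventually_ge_atTop 0] with t ht
      exact div_nonneg (hψ0 t) (zero_le_one.trans (hΨ1 t ht))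
    · filter_upwards [Filter.eventually_ge_atTop 0] with t ht
      rw [div_eq_mul_inv]
      exact mul_le_of_le_one_left (inv_nonneg.2 (zero_le_one.trans (hΨ1 t ht))) (hψ1 t)
  · refine Filter.tendsto_atTop_mono' _ ?_ hΨtop
    filter_upwards [Filter.eventually_ge_atTop 0] with t ht
    have h1 := one_pos.trans_le (hΨ1 t ht)
    rw [le_div_iff₀ (div_pos (hψpos t) h1), mul_div_cancel₀ _ h1.ne']
    exact min_le_left _ _
  · by_contra hne
    refine not_integrableOn_div_one_add_primitive hψ0 hloc hψni
      ((lintegral_ofReal_ne_top_iff_integrable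
        (hψmeas.div hΨmeas).aestronglyMeasurable ?_).1 hne)
    filter_upwards [ae_restrict_mem measurableSet_Ioi] with t ht
    exact div_nonneg (hψ0 t) (zero_le_one.trans (hΨ1 t (le_of_lt ht)))
end

section
/- Let ψ : (0,∞) → (0,∞) be a quasi-conformal function with ψ(t) → 0 as t → ∞. Then there exist c > 1 and T₀ > 1, depending only on ψ, such that for all T ≥ T₀: D_T(ψ) ⊆ C_{T/2}(cψ) and C_T(ψ) ⊆ D_{T/2}(cψ). -/
noncomputable section

/-- The quadratic form `Q(x) = 2 x₁ x_{d+1} + x₂² + ⋯ + x_p² − x_{p+1}² − ⋯ − x_d²`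
(in `0`-indexed coordinates). -/
def Qf (d p : ℕ) (x : Fin (d+1) → ℝ) : ℝ :=
  2 * x 0 * x (Fin.last d) +
    ∑ i : Fin (d+1), (if 1 ≤ (i : ℕ) ∧ (i : ℕ) < p then (x i)^2
      else if p ≤ (i : ℕ) ∧ (i : ℕ) < d then -(x i)^2 else 0)

/-- `D_T(ψ) = {x ∈ X : p(x) ≥ T, ‖x/p(x) − e₁‖ ≤ ψ(p(x))}` where `p(x) = |x₁|`
and `X = {Q = m}`. -/
def Dset (d p : ℕ) (m : ℝ) (ψ : ℝ → ℝ) (T : ℝ) :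
    Set (EuclideanSpace ℝ (Fin (d+1))) :=
  {x | Qf d p x = m ∧ T ≤ |x 0| ∧
    ‖|x 0|⁻¹ • x - EuclideanSpace.single 0 (1:ℝ)‖ ≤ ψ |x 0|}

/-- `C_T(ψ) = {x ∈ X : ‖x‖ ≥ T, ‖x/‖x‖ − e₁‖ ≤ ψ(‖x‖)}` where `X = {Q = m}`. -/
def Cset (d p : ℕ) (m : ℝ) (ψ : ℝ → ℝ) (T : ℝ) :
    Set (EuclideanSpace ℝ (Fin (d+1))) :=
  {x | Qf d p x = m ∧ T ≤ ‖x‖ ∧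
    ‖‖x‖⁻¹ • x - EuclideanSpace.single 0 (1:ℝ)‖ ≤ ψ ‖x‖}

/-- If `x / a` is within `δ ≤ 1/2` of a unit vector `e` and the scale `b` is within `δ * a` of `a`,
then `b` is comparable to `a` and `x / b` is within `4 * δ` of `e`. -/
theorem norm_inv_smul_sub_le_of_abs_sub_le {E : Type*} [NormedAddCommGroup E] [NormedSpace ℝ E]
    {x e : E} {a b δ : ℝ} (he : ‖e‖ = 1) (ha : 0 < a) (hδ : δ ≤ 1/2)
    (hx : ‖a⁻¹ • x - e‖ ≤ δ) (hab : |b - a| ≤ δ * a) :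
    a / 2 ≤ b ∧ a / b ∈ Set.Icc (1/2 : ℝ) 2 ∧ ‖b⁻¹ • x - e‖ ≤ 4 * δ := by
  have hδ' : δ * a ≤ a / 2 := by nlinarith
  obtain ⟨h1, h2⟩ := abs_le.1 hab
  have hb : 0 < b := by linarith
  have hratio : a / b ≤ 2 := by rw [div_le_iff₀ hb]; linarith
  refine ⟨by linarith, ⟨by rw [le_div_iff₀ hb]; linarith, hratio⟩, ?_⟩
  have hdecomp : b⁻¹ • x - e = (a / b) • (a⁻¹ • x - e) + (a / b - 1) • e := by
    rw [smul_sub, smul_smul, sub_smul, one_smul, show a / b * a⁻¹ = b⁻¹ by field_simp]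
    abel
  have hdiff : |a / b - 1| ≤ 2 * δ := by
    have hδ0 : 0 ≤ δ := (norm_nonneg _).trans hx
    rw [show a / b - 1 = (a - b) / b by field_simp, abs_div, abs_of_pos hb, div_le_iff₀ hb,
      abs_sub_comm]
    nlinarith
  calc ‖b⁻¹ • x - e‖ ≤ ‖(a / b) • (a⁻¹ • x - e)‖ + ‖(a / b - 1) • e‖ :=
        hdecomp ▸ norm_add_le _ _
    _ = a / b * ‖a⁻¹ • x - e‖ + |a / b - 1| := by
        rw [norm_smul, norm_smul, he, mul_one, Real.norm_eq_abs, Real.norm_eq_abs,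
          abs_of_pos (div_pos ha hb)]
    _ ≤ 2 * δ + 2 * δ := by gcongr
    _ = 4 * δ := by ring

/-- The norm of `x` differs from `a` by at most `a * ‖x / a - e‖` when `e` is a unit vector. -/
theorem abs_norm_sub_le_of_norm_inv_smul_sub_le {E : Type*} [NormedAddCommGroup E]
    [NormedSpace ℝ E] {x e : E} {a δ : ℝ} (he : ‖e‖ = 1) (ha : 0 < a)
    (hx : ‖a⁻¹ • x - e‖ ≤ δ) : |‖x‖ - a| ≤ δ * a := by
  have h := (abs_norm_sub_norm_le (a⁻¹ • x) e).trans hx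
  rwa [norm_smul, he, norm_inv, Real.norm_eq_abs, abs_of_pos ha,
    show a⁻¹ * ‖x‖ - 1 = (‖x‖ - a) / a by field_simp, abs_div, abs_of_pos ha,
    div_le_iff₀ ha] at h

/-- The modulus of the `i`-th coordinate of `x` differs from `a` by at most
`a * ‖x / a - eᵢ‖`. -/
theorem abs_abs_apply_sub_le_of_norm_inv_smul_sub_single_le {ι : Type*} [Fintype ι]
    [DecidableEq ι] {i : ι} {x : EuclideanSpace ℝ ι} {a δ : ℝ} (ha : 0 < a)
    (hx : ‖a⁻¹ • x - EuclideanSpace.single i (1:ℝ)‖ ≤ δ) : |(|x i|) - a| ≤ δ * a := by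
  have h := (PiLp.norm_apply_le (a⁻¹ • x - EuclideanSpace.single i (1:ℝ)) i).trans hx
  have hcoord : (a⁻¹ • x - EuclideanSpace.single i (1:ℝ)) i = (x i - a) / a := by
    simp
    field_simp
  rw [hcoord, Real.norm_eq_abs, abs_div, abs_of_pos ha, div_le_iff₀ ha] at h
  have habs := abs_abs_sub_abs_le (x i) a
  rw [abs_of_pos ha] at habs
  exact habs.trans h

/-- Lemma 2.3 of Gorodnik–Shah, "Khinchin theorem for integral points on quadratic
varieties".

Let `ψ : (0,∞) → (0,∞)` be a quasi-conformal function with `ψ(t) → 0` as `t → ∞`.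
Then there exist `c > 1` and `T₀ > 1`, depending only on `ψ`, such that for all
`T ≥ T₀` one has `D_T(ψ) ⊆ C_{T/2}(cψ)` and `C_T(ψ) ⊆ D_{T/2}(cψ)`. -/
theorem Dset_subset_Cset_and_Cset_subset_Dset
    (d p : ℕ) (hd : 3 ≤ d) (hp1 : 1 ≤ p) (hpd : p ≤ d)
    (m : ℝ) (hm : m ≠ 0)
    (ψ : ℝ → ℝ) (hψpos : ∀ t : ℝ, 0 < t → 0 < ψ t)
    (hqc : ∃ c₀ : ℝ, 0 < c₀ ∧ ∀ t : ℝ, 0 < t →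
      ∀ h ∈ Set.Icc (1/2 : ℝ) 2, ψ (h * t) ≤ c₀ * ψ t)
    (hψ0 : Filter.Tendsto ψ Filter.atTop (nhds 0)) :
    ∃ c : ℝ, 1 < c ∧ ∃ T₀ : ℝ, 1 < T₀ ∧ ∀ T : ℝ, T₀ ≤ T →
      Dset d p m ψ T ⊆ Cset d p m (fun t => c * ψ t) (T/2) ∧
      Cset d p m ψ T ⊆ Dset d p m (fun t => c * ψ t) (T/2) := by
  obtain ⟨c₀, hc₀, hqc⟩ := hqc
  obtain ⟨N, hN⟩ := Filter.eventually_atTop.1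
    (hψ0.eventually_le_const (show (0:ℝ) < 1/2 by norm_num))
  have hchange : ∀ T, max N 2 ≤ T → ∀ (x : EuclideanSpace ℝ (Fin (d+1))) (a b : ℝ), T ≤ a →
      ‖a⁻¹ • x - EuclideanSpace.single 0 (1:ℝ)‖ ≤ ψ a → |b - a| ≤ ψ a * a →
      T / 2 ≤ b ∧ ‖b⁻¹ • x - EuclideanSpace.single 0 (1:ℝ)‖ ≤ (4 * c₀ + 1) * ψ b := by
    intro T hT x a b hTa hx hab
    obtain ⟨hNT, h2T⟩ := max_le_iff.1 hT
    have ha : 0 < a := by linarith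
    obtain ⟨hb, hratio, hbound⟩ :=
      norm_inv_smul_sub_le_of_abs_sub_le (by simp) ha (hN a (by linarith)) hx hab
    have hb0 : 0 < b := by linarith
    have hψab := hqc b hb0 _ hratio
    rw [div_mul_cancel₀ a hb0.ne'] at hψab
    exact ⟨by linarith, by linarith [hψpos b hb0]⟩
  refine ⟨4 * c₀ + 1, by linarith, max N 2, by simp, fun T hT => ⟨?_, ?_⟩⟩
  · rintro x ⟨hQ, hTx, hx⟩
    have hpos : 0 < |x 0| := by linarith [le_max_right N 2]
    exact ⟨hQ, hchange T hT x _ _ hTx hx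
      (abs_norm_sub_le_of_norm_inv_smul_sub_le (by simp) hpos hx)⟩
  · rintro x ⟨hQ, hTx, hx⟩
    have hpos : 0 < ‖x‖ := by linarith [le_max_right N 2]
    exact ⟨hQ, hchange T hT x _ _ hTx hx
      (abs_abs_apply_sub_le_of_norm_inv_smul_sub_single_le hpos hx)⟩

end
end

section
/- Let ψ : (0,∞) → (0,∞) be a measurable quasi-conformal function such that e^t ψ(e^t) → 0 as t → ∞. Then ∫₀^∞ (e^t ψ(e^t))^{d−1} dt = ∞ if and only if ∫₀^∞ λ(U_t(ψ)) dt = ∞. -/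
open MeasureTheory

noncomputable section

/-- The region
`U_t(ψ) = {s ∈ ℝ^{d−1} : |m − ‖s₁‖² + ‖s₂‖²| ≤ 2 e^{2t} ψ(e^t), ‖s‖ ≤ e^t ψ(e^t)}`,
where `s = (s₁, s₂)` with `s₁ ∈ ℝ^{p−1}` the first `p−1` coordinates and
`s₂ ∈ ℝ^{d−p}` the remaining ones. -/
def Uregion (d p : ℕ) (m : ℝ) (ψ : ℝ → ℝ) (t : ℝ) :
    Set (EuclideanSpace ℝ (Fin (d-1))) :=
  {s | |m - (∑ k : Fin (d-1), if (k : ℕ) + 2 ≤ p then (s k)^2 else 0)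
          + ∑ k : Fin (d-1), if (k : ℕ) + 2 ≤ p then 0 else (s k)^2|
        ≤ 2 * Real.exp (2*t) * ψ (Real.exp t) ∧
      ‖s‖ ≤ Real.exp t * ψ (Real.exp t)}

/-- A region `Uregion d p m ψ t` lies in the closed ball of radius `e^t ψ(e^t)`. -/
lemma Uregion_subset_closedBall (d p : ℕ) (m : ℝ) (ψ : ℝ → ℝ) (t : ℝ) :
    Uregion d p m ψ t ⊆ Metric.closedBall 0 (Real.exp t * ψ (Real.exp t)) := by
  intro s hs
  simpa using hs.2

/-- If `e^t ψ(e^t) ≤ 1` and `|m| + 1 ≤ 2 e^{2t} ψ(e^t)`, then the quadratic constraint in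
`Uregion d p m ψ t` is implied by the norm constraint. -/
lemma closedBall_subset_Uregion (d p : ℕ) (m : ℝ) (ψ : ℝ → ℝ) (t : ℝ)
    (hle : Real.exp t * ψ (Real.exp t) ≤ 1)
    (hlarge : |m| + 1 ≤ 2 * Real.exp (2 * t) * ψ (Real.exp t)) :
    Metric.closedBall 0 (Real.exp t * ψ (Real.exp t)) ⊆ Uregion d p m ψ t := by
  intro s hs
  have hs' : ‖s‖ ≤ Real.exp t * ψ (Real.exp t) := by simpa using hs
  refine ⟨le_trans ?_ hlarge, hs'⟩
  set a := ∑ k : Fin (d-1), if (k : ℕ) + 2 ≤ p then (s k)^2 else 0 with ha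
  set b := ∑ k : Fin (d-1), if (k : ℕ) + 2 ≤ p then 0 else (s k)^2 with hb
  have ha0 : 0 ≤ a := Finset.sum_nonneg fun k _ => by split_ifs <;> positivity
  have hb0 : 0 ≤ b := Finset.sum_nonneg fun k _ => by split_ifs <;> positivity
  have hab : a + b = ‖s‖ ^ 2 := by
    rw [EuclideanSpace.real_norm_sq_eq, ha, hb, ← Finset.sum_add_distrib]
    exact Finset.sum_congr rfl fun k _ => by split_ifs <;> simp
  have hsq : ‖s‖ ^ 2 ≤ 1 := pow_le_one₀ (norm_nonneg s) (hs'.trans hle)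
  rw [abs_le]
  constructor <;> linarith [neg_abs_le m, le_abs_self m]

/-- A quasi-conformal function is bounded above on `[1, 2 ^ k]`. -/
lemma exists_bound_of_quasiconformal {ψ : ℝ → ℝ} {c : ℝ}
    (hqc : ∀ t : ℝ, 0 < t → ∀ h ∈ Set.Icc (1/2 : ℝ) 2, ψ (h * t) ≤ c * ψ t)
    (hc : 0 < c) (k : ℕ) :
    ∃ M : ℝ, ∀ x ∈ Set.Icc (1 : ℝ) (2 ^ k), ψ x ≤ M := by
  induction k with
  | zero =>
    refine ⟨ψ 1, fun x hx => ?_⟩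
    have : x = 1 := le_antisymm (by simpa using hx.2) hx.1
    rw [this]
  | succ k ih =>
    obtain ⟨M, hM⟩ := ih
    refine ⟨max M (c * M), fun x hx => ?_⟩
    rcases le_total x (2 ^ k) with h | h
    · exact (hM x ⟨hx.1, h⟩).trans (le_max_left _ _)
    · refine le_trans ?_ (le_max_right _ _)
      have hk : (1 : ℝ) ≤ 2 ^ k := one_le_pow₀ one_le_two
      have hk0 : (0 : ℝ) < 2 ^ k := by positivity
      have hx2 : x ≤ 2 ^ k * 2 := by simpa [pow_succ] using hx.2
      have := hqc (2 ^ k) hk0 (x / 2 ^ k)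
        ⟨by rw [le_div_iff₀ hk0]; linarith, by rw [div_le_iff₀ hk0]; linarith⟩
      rw [div_mul_cancel₀ _ hk0.ne'] at this
      exact this.trans (mul_le_mul_of_nonneg_left (hM _ ⟨hk, le_rfl⟩) hc.le)

/-- A quasi-conformal function, viewed on the exponential scale, is bounded above on every bounded
subinterval of `(0, ∞)`. -/
lemma exists_exp_mul_le_of_quasiconformal {ψ : ℝ → ℝ} {c : ℝ}
    (hψpos : ∀ t : ℝ, 0 < t → 0 < ψ t)
    (hqc : ∀ t : ℝ, 0 < t → ∀ h ∈ Set.Icc (1/2 : ℝ) 2, ψ (h * t) ≤ c * ψ t)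
    (hc : 0 < c) (T : ℝ) :
    ∃ B : ℝ, ∀ t : ℝ, 0 < t → t ≤ T → Real.exp t * ψ (Real.exp t) ≤ B := by
  obtain ⟨k, hk⟩ := pow_unbounded_of_one_lt (Real.exp T) one_lt_two
  obtain ⟨M, hM⟩ := exists_bound_of_quasiconformal hqc hc k
  refine ⟨Real.exp T * M, fun t ht htT => ?_⟩
  have hle : Real.exp t ≤ Real.exp T := Real.exp_le_exp.mpr htT
  exact mul_le_mul hle (hM _ ⟨Real.one_le_exp ht.le, hle.trans hk.le⟩)
    (hψpos _ (Real.exp_pos t)).le (Real.exp_pos T).le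

/-- Equation (2.11) in the proof of Theorem 2.1 of Gorodnik–Shah, "Khinchin theorem
for integral points on quadratic varieties".

Let `ψ : (0,∞) → (0,∞)` be a measurable quasi-conformal function with
`e^t ψ(e^t) → 0` as `t → ∞`.  Then `∫₀^∞ (e^t ψ(e^t))^{d−1} dt = ∞` if and only if
`∫₀^∞ λ(U_t(ψ)) dt = ∞`, where `λ` is the Lebesgue measure on `ℝ^{d−1}`. -/
theorem lintegral_pow_eq_top_iff_lintegral_volume_Uregion_eq_top
    (d p : ℕ) (hd : 3 ≤ d) (hp1 : 1 ≤ p) (hpd : p ≤ d)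
    (m : ℝ) (hm : m ≠ 0)
    (ψ : ℝ → ℝ) (hψpos : ∀ t : ℝ, 0 < t → 0 < ψ t) (hψmeas : Measurable ψ)
    (hqc : ∃ c : ℝ, 0 < c ∧ ∀ t : ℝ, 0 < t →
      ∀ h ∈ Set.Icc (1/2 : ℝ) 2, ψ (h * t) ≤ c * ψ t)
    (hψ0 : Filter.Tendsto (fun t : ℝ => Real.exp t * ψ (Real.exp t))
      Filter.atTop (nhds 0)) :
    (∫⁻ t in Set.Ioi (0 : ℝ),
        ENNReal.ofReal ((Real.exp t * ψ (Real.exp t)) ^ (d - 1)) = ⊤) ↔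
    (∫⁻ t in Set.Ioi (0 : ℝ), volume (Uregion d p m ψ t) = ⊤) := by
  obtain ⟨c, hc, hqc⟩ := hqc
  set r : ℝ → ℝ := fun t => Real.exp t * ψ (Real.exp t) with hr
  have hr0 (t : ℝ) : 0 ≤ r t := (mul_pos (Real.exp_pos t) (hψpos _ (Real.exp_pos t))).le
  set κ := volume (Metric.ball (0 : EuclideanSpace ℝ (Fin (d - 1))) 1) with hκ
  have hκ_top : κ ≠ ⊤ := measure_ball_lt_top.ne
  have hκ_zero : κ ≠ 0 := (Metric.measure_ball_pos volume _ one_pos).ne'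
  have hball (t : ℝ) : volume (Metric.closedBall (0 : EuclideanSpace ℝ (Fin (d - 1))) (r t)) =
      κ * ENNReal.ofReal (r t ^ (d - 1)) := by
    rw [Measure.addHaar_closedBall _ _ (hr0 t), finrank_euclideanSpace_fin, mul_comm]
  have hconst : ∫⁻ t in Set.Ioi (0 : ℝ), κ * ENNReal.ofReal (r t ^ (d - 1)) =
      κ * ∫⁻ t in Set.Ioi (0 : ℝ), ENNReal.ofReal (r t ^ (d - 1)) :=
    lintegral_const_mul' _ _ hκ_top
  constructor
  · intro hint
    obtain ⟨T, hT⟩ := Filter.eventually_atTop.mp (hψ0.eventually (eventually_le_nhds one_pos))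
    obtain ⟨B, hB⟩ := exists_exp_mul_le_of_quasiconformal hψpos hqc hc T
    set D : ℝ := (|m| + 1) / 2 with hD
    set g : ℝ → ENNReal := fun t =>
      (Set.Iic T).indicator (fun _ => ENNReal.ofReal (B ^ (d - 1))) t +
        ENNReal.ofReal (D ^ (d - 1) * Real.exp (-t)) with hg
    have hgmeas : Measurable g :=
      (measurable_const.indicator measurableSet_Iic).add (by fun_prop)
    have hg_top : ∫⁻ t in Set.Ioi (0 : ℝ), g t ≠ ⊤ := by
      rw [hg, lintegral_add_right _ (by fun_prop)]
      refine ENNReal.add_ne_top.mpr ⟨?_, ?_⟩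
      · rw [lintegral_indicator_const measurableSet_Iic,
          Measure.restrict_apply measurableSet_Iic, Set.Iic_inter_Ioi]
        exact ENNReal.mul_ne_top ENNReal.ofReal_ne_top measure_Ioc_lt_top.ne
      · exact ((integrableOn_exp_neg_Ioi 0).const_mul (D ^ (d - 1))).lintegral_lt_top.ne
    have hbound : ∀ t ∈ Set.Ioi (0 : ℝ), κ * ENNReal.ofReal (r t ^ (d - 1)) ≤
        volume (Uregion d p m ψ t) + κ * g t := by
      intro t ht
      rcases le_or_gt t T with htT | htT
      · refine le_add_left (mul_le_mul_right (le_add_right ?_) κ)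
        rw [Set.indicator_of_mem (Set.mem_Iic.mpr htT)]
        exact ENNReal.ofReal_le_ofReal (pow_le_pow_left₀ (hr0 t) (hB t ht htT) _)
      rcases le_or_gt (|m| + 1) (2 * Real.exp (2 * t) * ψ (Real.exp t)) with hlarge | hsmall
      · refine le_add_right ?_
        rw [← hball]
        exact measure_mono (closedBall_subset_Uregion d p m ψ t (hT t htT.le) hlarge)
      · refine le_add_left (mul_le_mul_right (le_add_left (ENNReal.ofReal_le_ofReal ?_)) κ)
        have hrD : r t ≤ D * Real.exp (-t) := by
          rw [Real.exp_neg, ← div_eq_mul_inv, le_div_iff₀ (Real.exp_pos t)]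
          rw [two_mul t, Real.exp_add] at hsmall
          simp only [hr, hD]
          linarith
        calc r t ^ (d - 1) ≤ (D * Real.exp (-t)) ^ (d - 1) := pow_le_pow_left₀ (hr0 t) hrD _
          _ = D ^ (d - 1) * Real.exp (-t) ^ (d - 1) := mul_pow _ _ _
          _ ≤ D ^ (d - 1) * Real.exp (-t) := by
            refine mul_le_mul_of_nonneg_left ?_ (by positivity)
            exact pow_le_of_le_one (Real.exp_pos _).le
              (Real.exp_le_one_iff.mpr (neg_nonpos.mpr (le_of_lt ht))) (by lia)
    by_contra hU
    have hle := setLIntegral_mono' (μ := volume) measurableSet_Ioi hbound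
    rw [hconst, hint, ENNReal.mul_top hκ_zero, lintegral_add_right _ (hgmeas.const_mul κ),
      lintegral_const_mul' _ _ hκ_top, top_le_iff] at hle
    exact ENNReal.add_ne_top.mpr ⟨hU, ENNReal.mul_ne_top hκ_top hg_top⟩ hle
  · intro hU
    by_contra hint
    have hle : ∫⁻ t in Set.Ioi (0 : ℝ), volume (Uregion d p m ψ t) ≤
        κ * ∫⁻ t in Set.Ioi (0 : ℝ), ENNReal.ofReal (r t ^ (d - 1)) := by
      rw [← hconst]
      exact lintegral_mono fun t =>
        (measure_mono (Uregion_subset_closedBall d p m ψ t)).trans_eq (hball t)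
    rw [hU, top_le_iff] at hle
    exact ENNReal.mul_ne_top hκ_top hint hle

end
end
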